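/- arXiv:1804.07033 — 2 statements merged into one kernel-verified Lean document; each statement's English description precedes it below -/
import Mathlib

section
/- Let ε > 0, let f : (0, ε] → ℂ be a measurable bounded function, and suppose f(t) → L as t → 0⁺ for some L ∈ ℂ. Then lim_{z → 0⁺} z · ∫_0^ε 2 t^{2z−1} f(t) dt = L, where the limit is taken over real z > 0. -/
open MeasureTheory Set Filter

/-- The kernel `2 z t ^ (2 z - 1)` on `(0, ε]` has total mass `ε ^ (2 z)`. -/
lemma setIntegral_two_mul_rpow {ε z : ℝ} (hε : 0 < ε) (hz : 0 < z) :
    ∫ t in Ioc 0 ε, 2 * z * t ^ (2 * z - 1) = ε ^ (2 * z) := by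
  rw [← intervalIntegral.integral_of_le hε.le, intervalIntegral.integral_const_mul,
    integral_rpow (Or.inl (by linarith)), sub_add_cancel, Real.zero_rpow (by positivity), sub_zero]
  field_simp

/-- Away from the origin the kernels `2 z t ^ (2 z - 1)` tend to zero uniformly as `z → 0⁺`. -/
lemma tendstoUniformlyOn_two_mul_rpow {δ : ℝ} (hδ : 0 < δ) :
    TendstoUniformlyOn (fun z t : ℝ => 2 * z * t ^ (2 * z - 1)) 0
      (nhdsWithin 0 (Ioi 0)) (Ici δ) := by
  have hlim : Tendsto (fun z : ℝ => 2 * z * δ ^ (2 * z - 1)) (nhdsWithin 0 (Ioi 0)) (nhds 0) := by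
    have hcont : Continuous fun z : ℝ => 2 * z * δ ^ (2 * z - 1) :=
      (by fun_prop : Continuous fun z : ℝ => 2 * z).mul
        ((Real.continuous_const_rpow hδ.ne').comp
          (by fun_prop : Continuous fun z : ℝ => 2 * z - 1))
    simpa using (hcont.tendsto 0).mono_left nhdsWithin_le_nhds
  rw [Metric.tendstoUniformlyOn_iff]
  intro η hη
  filter_upwards [hlim.eventually (gt_mem_nhds hη),
    Ioo_mem_nhdsGT (by norm_num : (0 : ℝ) < 1 / 2)] with z hz hz' t ht
  have ht0 : 0 < t := hδ.trans_le ht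
  have hz0 : 0 < z := hz'.1
  rw [Pi.zero_apply, dist_zero_left, Real.norm_of_nonneg (by positivity)]
  refine lt_of_le_of_lt ?_ hz
  exact mul_le_mul_of_nonneg_left
    (Real.rpow_le_rpow_of_nonpos hδ ht (by linarith [hz'.2])) (by positivity)

/-- Let `ε > 0` and `f : (0, ε] → ℂ` be measurable and bounded with `f t → L` as `t → 0⁺`.
Then `z * ∫_0^ε 2 t^{2z−1} f(t) dt → L` as `z → 0⁺` over real `z > 0`, where
`t ^ (2z−1) = exp ((2z−1) * log t)` is the real power. -/
theorem abelian_limit (ε : ℝ) (hε : 0 < ε) (f : ℝ → ℂ)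
    (hf : AEStronglyMeasurable f (volume.restrict (Ioc 0 ε)))
    (C : ℝ) (hC : ∀ t ∈ Ioc (0 : ℝ) ε, ‖f t‖ ≤ C)
    (L : ℂ) (hL : Tendsto f (nhdsWithin 0 (Ioi 0)) (nhds L)) :
    Tendsto (fun z : ℝ =>
        (z : ℂ) * ∫ t in Ioc 0 ε, 2 * ((t ^ (2 * z - 1) : ℝ) : ℂ) * f t)
      (nhdsWithin 0 (Ioi 0)) (nhds L) := by
  have hint : IntegrableOn f (Ioc 0 ε) :=
    IntegrableOn.of_bound measure_Ioc_lt_top hf C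
      ((ae_restrict_iff' measurableSet_Ioc).2 (ae_of_all _ hC))
  have hmass : Tendsto (fun z : ℝ => ∫ t in Ioc 0 ε, 2 * z * t ^ (2 * z - 1))
      (nhdsWithin 0 (Ioi 0)) (nhds 1) := by
    have hcont : Continuous fun z : ℝ => ε ^ (2 * z) :=
      (Real.continuous_const_rpow hε.ne').comp (by fun_prop : Continuous fun z : ℝ => 2 * z)
    have hlim : Tendsto (fun z : ℝ => ε ^ (2 * z)) (nhdsWithin 0 (Ioi 0)) (nhds 1) := by
      simpa using (hcont.tendsto 0).mono_left nhdsWithin_le_nhds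
    refine hlim.congr' ?_
    filter_upwards [self_mem_nhdsWithin] with z hz
    exact (setIntegral_two_mul_rpow hε hz).symm
  have hpeak := tendsto_setIntegral_peak_smul_of_integrableOn_of_tendsto
    (μ := volume) (s := Ioc 0 ε) (t := Ioc 0 ε) (x₀ := (0 : ℝ)) (a := L) (g := f)
    (l := nhdsWithin (0 : ℝ) (Ioi 0)) (φ := fun z t : ℝ => 2 * z * t ^ (2 * z - 1))
    measurableSet_Ioc measurableSet_Ioc Subset.rfl self_mem_nhdsWithin measure_Ioc_lt_top.ne
    (by
      filter_upwards [self_mem_nhdsWithin] with z hz t ht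
      have hz0 : 0 < z := hz
      have ht0 : 0 < t := ht.1
      positivity)
    (by
      intro u hu h0
      obtain ⟨δ, hδ, hball⟩ := Metric.isOpen_iff.1 hu 0 h0
      refine (tendstoUniformlyOn_two_mul_rpow hδ).mono fun t ht => ?_
      by_contra hlt
      refine ht.2 (hball ?_)
      rw [mem_ball_zero_iff, Real.norm_of_nonneg ht.1.1.le]
      exact not_le.1 hlt)
    hmass
    (Eventually.of_forall fun z => by
      have : Measurable fun t : ℝ => 2 * z * t ^ (2 * z - 1) := by fun_prop
      exact this.aestronglyMeasurable)
    hint (hL.mono_left (nhdsWithin_mono _ Ioc_subset_Ioi_self))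
  refine hpeak.congr fun z => ?_
  rw [← integral_const_mul]
  refine integral_congr_ae (ae_of_all _ fun t => ?_)
  simp only [Complex.real_smul]
  push_cast
  ring
end

section
/- Let f : (0, ∞) → ℂ be a measurable bounded function with f(t) → L as t → 0⁺ for some L ∈ ℂ. Then for every real z > 0 the function t ↦ 2 t^{2z−1} e^{−t²} f(t) is integrable on (0, ∞), and lim_{z → 0⁺} z · ∫_0^∞ 2 t^{2z−1} e^{−t²} f(t) dt = L, where the limit is over real z > 0. -/
open MeasureTheory Set Filter

/-- The kernels `t ↦ 2 z t ^ (2z − 1)` tend to zero, as `z → 0⁺`, uniformly on the part of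
`(0,∞)` outside any neighbourhood of `0`. -/
lemma tendstoUniformlyOn_two_mul_rpow_sdiff {u : Set ℝ} (hu : u ∈ nhds 0) :
    TendstoUniformlyOn (fun z t : ℝ => 2 * z * t ^ (2 * z - 1)) 0
      (nhdsWithin 0 (Ioi 0)) (Ioi 0 \ u) := by
  obtain ⟨δ, hδ, hball⟩ := Metric.mem_nhds_iff.1 hu
  have hlim : Tendsto (fun z : ℝ => 2 * z * δ ^ (2 * z - 1)) (nhdsWithin 0 (Ioi 0)) (nhds 0) := by
    have hcont : Continuous fun z : ℝ => 2 * z * δ ^ (2 * z - 1) :=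
      (by fun_prop : Continuous fun z : ℝ => 2 * z).mul
        (continuous_const.rpow (by fun_prop) fun _ => Or.inl hδ.ne')
    simpa using (hcont.tendsto 0).mono_left nhdsWithin_le_nhds
  rw [Metric.tendstoUniformlyOn_iff]
  intro ε hε
  have hhalf : ∀ᶠ z : ℝ in nhdsWithin 0 (Ioi 0), z < 1 / 2 :=
    nhdsWithin_le_nhds (Iio_mem_nhds (by norm_num))
  filter_upwards [hlim.eventually_lt_const hε, hhalf, self_mem_nhdsWithin] with z hz hz' hz0 t ht
  have ht0 : 0 < t := ht.1
  have hz0 : 0 < z := hz0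
  have hδt : δ ≤ t := by
    by_contra! h
    exact ht.2 (hball (by simpa [abs_of_pos ht0] using h))
  have hle : t ^ (2 * z - 1) ≤ δ ^ (2 * z - 1) :=
    Real.rpow_le_rpow_of_nonpos hδ hδt (by linarith)
  rw [dist_comm, Pi.zero_apply, Real.dist_0_eq_abs, abs_of_nonneg (by positivity)]
  exact (mul_le_mul_of_nonneg_left hle (by positivity)).trans_lt hz

/-- On `(0,1]` the kernel `t ↦ 2 z t ^ (2z − 1)` has integral one. -/
lemma setIntegral_two_mul_rpow_Ioc {z : ℝ} (hz : 0 < z) :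
    ∫ t in Ioc (0 : ℝ) 1, 2 * z * t ^ (2 * z - 1) = 1 := by
  rw [← intervalIntegral.integral_of_le zero_le_one, intervalIntegral.integral_const_mul,
    integral_rpow (Or.inl (by linarith))]
  rw [sub_add_cancel, Real.one_rpow, Real.zero_rpow (by positivity)]
  field_simp
  norm_num

/-- If `g` is integrable on `(0,∞)` and tends to `a` at `0⁺`, then
`∫_0^∞ 2 z t ^ (2z − 1) g(t) dt → a` as `z → 0⁺`. -/
lemma tendsto_setIntegral_two_mul_rpow_smul {E : Type*} [NormedAddCommGroup E] [NormedSpace ℝ E]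
    [CompleteSpace E] {g : ℝ → E} {a : E} (hg : IntegrableOn g (Ioi 0))
    (ha : Tendsto g (nhdsWithin 0 (Ioi 0)) (nhds a)) :
    Tendsto (fun z : ℝ => ∫ t in Ioi (0 : ℝ), (2 * z * t ^ (2 * z - 1)) • g t)
      (nhdsWithin 0 (Ioi 0)) (nhds a) := by
  refine tendsto_setIntegral_peak_smul_of_integrableOn_of_tendsto measurableSet_Ioi
    (measurableSet_Ioc (a := (0 : ℝ)) (b := 1)) Ioc_subset_Ioi_self
    (Ioc_mem_nhdsGT zero_lt_one) (by simp) ?_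
    (fun u hu h0 => tendstoUniformlyOn_two_mul_rpow_sdiff (hu.mem_nhds h0)) ?_ ?_ hg ha
  · filter_upwards [self_mem_nhdsWithin] with z (hz : 0 < z) t (ht : 0 < t)
    positivity
  · refine tendsto_const_nhds.congr' ?_
    filter_upwards [self_mem_nhdsWithin] with z hz
    exact (setIntegral_two_mul_rpow_Ioc hz).symm
  · exact Eventually.of_forall fun z => by fun_prop

/-- A Gaussian weight times a power `t ^ s`, `s > -1`, times a bounded measurable function is
integrable on `(0,∞)`. -/
lemma integrableOn_rpow_mul_exp_neg_sq_mul_of_bounded {f : ℝ → ℂ}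
    (hf : AEStronglyMeasurable f (volume.restrict (Ioi 0))) {C : ℝ}
    (hC : ∀ t ∈ Ioi (0 : ℝ), ‖f t‖ ≤ C) {s : ℝ} (hs : -1 < s) :
    IntegrableOn (fun t : ℝ => ((t ^ s * Real.exp (-t ^ 2) : ℝ) : ℂ) * f t) (Ioi 0) := by
  have h : IntegrableOn (fun t : ℝ => t ^ s * Real.exp (-t ^ 2)) (Ioi 0) := by
    simpa using integrableOn_rpow_mul_exp_neg_mul_sq one_pos hs
  exact Integrable.mul_bdd h.ofReal hf ((ae_restrict_iff' measurableSet_Ioi).2 (ae_of_all _ hC))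

/-- Let `f : (0,∞) → ℂ` be measurable and bounded with `f t → L` as `t → 0⁺`.  Then for
every real `z > 0` the function `t ↦ 2 t^{2z−1} e^{−t²} f t` is integrable on `(0,∞)`,
and `z * ∫_0^∞ 2 t^{2z−1} e^{−t²} f(t) dt → L` as `z → 0⁺` over real `z > 0`.  Here
`t ^ (2z−1) = exp ((2z−1) * log t)` is the real power. -/
theorem residue_eval (f : ℝ → ℂ)
    (hf : AEStronglyMeasurable f (volume.restrict (Ioi 0)))
    (C : ℝ) (hC : ∀ t ∈ Ioi (0 : ℝ), ‖f t‖ ≤ C)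
    (L : ℂ) (hL : Tendsto f (nhdsWithin 0 (Ioi 0)) (nhds L)) :
    (∀ z : ℝ, 0 < z → IntegrableOn
      (fun t : ℝ => 2 * ((t ^ (2 * z - 1) * Real.exp (-t ^ 2) : ℝ) : ℂ) * f t) (Ioi 0)) ∧
    Tendsto (fun z : ℝ =>
        (z : ℂ) * ∫ t in Ioi 0, 2 * ((t ^ (2 * z - 1) * Real.exp (-t ^ 2) : ℝ) : ℂ) * f t)
      (nhdsWithin 0 (Ioi 0)) (nhds L) := by
  constructor
  · intro z hz
    simpa only [IntegrableOn, mul_assoc] using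
      (integrableOn_rpow_mul_exp_neg_sq_mul_of_bounded hf hC
        (by linarith : -1 < 2 * z - 1)).const_mul 2
  · have hg : IntegrableOn (fun t : ℝ => ((Real.exp (-t ^ 2) : ℝ) : ℂ) * f t) (Ioi 0) := by
      simpa using integrableOn_rpow_mul_exp_neg_sq_mul_of_bounded hf hC neg_one_lt_zero
    have hexp : Tendsto (fun t : ℝ => ((Real.exp (-t ^ 2) : ℝ) : ℂ))
        (nhdsWithin 0 (Ioi 0)) (nhds 1) := by
      have hcont : Continuous fun t : ℝ => ((Real.exp (-t ^ 2) : ℝ) : ℂ) := by fun_prop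
      simpa using (hcont.tendsto 0).mono_left nhdsWithin_le_nhds
    have hlim : Tendsto (fun t : ℝ => ((Real.exp (-t ^ 2) : ℝ) : ℂ) * f t)
        (nhdsWithin 0 (Ioi 0)) (nhds L) := by
      simpa using hexp.mul hL
    refine (tendsto_setIntegral_two_mul_rpow_smul hg hlim).congr fun z => ?_
    rw [← integral_const_mul]
    refine integral_congr_ae (ae_of_all _ fun t => ?_)
    simp only [Complex.real_smul, Complex.ofReal_mul, Complex.ofReal_ofNat]
    ring
end
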